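/- There exists a permutation of length 7 that is not sortable by two stacks in series; equivalently, the number of sortable permutations of length 7 is strictly less than 7!. -/

import Mathlib

namespace TwoStacks

/-- A state of the two-stacks-in-series machine: remaining input,
stack 1, stack 2 (tops at the head), and the output so far. -/
structure St where
  inp : List ℕ
  s1 : List ℕ
  s2 : List ℕ
  out : List ℕ
deriving DecidableEq

/-- The three moves. -/
inductive Mv
  | rho  -- input → stack 1
  | lam  -- stack 1 → stack 2
  | mu   -- stack 2 → output
deriving DecidableEq

/-- One move of the machine (`none` if the move is not applicable). -/
def step : Mv → St → Option St
  | .rho, ⟨x :: xs, s1, s2, o⟩ => some ⟨xs, x :: s1, s2, o⟩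
  | .lam, ⟨i, x :: xs, s2, o⟩ => some ⟨i, xs, x :: s2, o⟩
  | .mu,  ⟨i, s1, x :: xs, o⟩ => some ⟨i, s1, xs, o ++ [x]⟩
  | _, _ => none

/-- Run a word of moves on a state. -/
def run (w : List Mv) (s : St) : Option St :=
  w.foldlM (fun s m => step m s) s

/-- The list 1,2,…,n. -/
def idSeq (n : ℕ) : List ℕ := (List.range n).map (· + 1)

/-- The one-line notation p(1),…,p(n) (values in {1,…,n}) of a permutation. -/
def permList {n : ℕ} (p : Equiv.Perm (Fin n)) : List ℕ :=
  List.ofFn fun i => (p i : ℕ) + 1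

/-- p is achievable: from input 1,…,n some word of moves outputs p(1),…,p(n). -/
def Achievable {n : ℕ} (p : Equiv.Perm (Fin n)) : Prop :=
  ∃ w, run w ⟨idSeq n, [], [], []⟩ = some ⟨[], [], [], permList p⟩

/-- p is sortable: from input p(1),…,p(n) some word of moves outputs 1,…,n. -/
def Sortable {n : ℕ} (p : Equiv.Perm (Fin n)) : Prop :=
  ∃ w, run w ⟨permList p, [], [], []⟩ = some ⟨[], [], [], idSeq n⟩

/-- A list of (distinct) naturals is achievable as an output. -/
def AchList (l : List ℕ) : Prop :=
  ∃ w, run w ⟨idSeq l.length, [], [], []⟩ = some ⟨[], [], [], l⟩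

/-- Standardization (pattern) of a list with distinct entries:
each entry is replaced by its rank (1-based). -/
def std (l : List ℕ) : List ℕ :=
  l.map fun x => (l.filter (· ≤ x)).length

/-- An operation sequence of length 3n: n of each letter, and every
prefix has #ρ ≥ #λ ≥ #μ. -/
def OpSeq (n : ℕ) (w : List Mv) : Prop :=
  w.length = 3 * n ∧ w.count .rho = n ∧ w.count .lam = n ∧ w.count .mu = n ∧
  ∀ u, u <+: w → u.count .mu ≤ u.count .lam ∧ u.count .lam ≤ u.count .rho

/-- An x,y-Catalan word: word over {x,y} with equally many x's and y's
in which every prefix has at least as many x's as y's. -/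
def CatWord (x y : Mv) (w : List Mv) : Prop :=
  (∀ m ∈ w, m = x ∨ m = y) ∧ w.count x = w.count y ∧
  ∀ u, u <+: w → u.count y ≤ u.count x

/-- Two words have the same effect: applied to any state on which both
are applicable, they give the same resulting state. -/
def SameEffect (v v' : List Mv) : Prop :=
  ∀ s t t', run v s = some t → run v' s = some t' → t = t'

/-- Rank of a letter for the order ρ < λ < μ. -/
def rk : Mv → ℕ
  | .rho => 0
  | .lam => 1
  | .mu => 2

/-- The order ρ < λ < μ on letters. -/
def mlt (a b : Mv) : Prop := rk a < rk b

/-- Lexicographic order on words induced by ρ < λ < μ. -/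
def wordLt (v v' : List Mv) : Prop := List.Lex mlt v v'

/-- No entry is immediately followed by its successor. -/
def IncAvoid (l : List ℕ) : Prop :=
  ∀ j (h : j + 1 < l.length), l.get ⟨j + 1, h⟩ ≠ l.get ⟨j, by omega⟩ + 1

/-- Every word of moves emptying the machine has length determined by the initial state. -/
theorem length_of_run_eq_some (w : List Mv) (i a b o o' : List ℕ)
    (h : run w ⟨i, a, b, o⟩ = some ⟨[], [], [], o'⟩) :
    w.length = 3 * i.length + 2 * a.length + b.length := by
  induction w generalizing i a b o with
  | nil => simp_all [run]
  | cons m w ih =>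
    cases m
    · cases i with
      | nil => simp [run, step] at h
      | cons x i =>
        have := ih i (x :: a) b o (by simpa [run, step] using h)
        simp only [List.length_cons] at this ⊢
        omega
    · cases a with
      | nil => simp [run, step] at h
      | cons x a =>
        have := ih i a (x :: b) o (by simpa [run, step] using h)
        simp only [List.length_cons] at this ⊢
        omega
    · cases b with
      | nil => simp [run, step] at h
      | cons x b =>
        have := ih i a b (o ++ [x]) (by simpa [run, step] using h)
        simp only [List.length_cons] at this ⊢
        omega

/-- The moves of a run only append to the output, and the second stack leaves in order. -/
theorem exists_output_of_run_eq_some (w : List Mv) (i a b o o' : List ℕ)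
    (h : run w ⟨i, a, b, o⟩ = some ⟨[], [], [], o'⟩) :
    ∃ t, o' = o ++ t ∧ b.Sublist t := by
  induction w generalizing i a b o with
  | nil => simp_all [run]
  | cons m w ih =>
    cases m
    · cases i with
      | nil => simp [run, step] at h
      | cons x i => exact ih i (x :: a) b o (by simpa [run, step] using h)
    · cases a with
      | nil => simp [run, step] at h
      | cons x a =>
        obtain ⟨t, ht, hs⟩ := ih i a (x :: b) o (by simpa [run, step] using h)
        exact ⟨t, ht, (List.sublist_cons_self x b).trans hs⟩
    · cases b with
      | nil => simp [run, step] at h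
      | cons x b =>
        obtain ⟨t, ht, hs⟩ := ih i a b (o ++ [x]) (by simpa [run, step] using h)
        exact ⟨x :: t, by simpa using ht, hs.cons_cons x⟩

/-- Search for `n` consecutive moves from input `i` and stacks `a`, `b` that follow the
required output `t`, discarding states whose second stack is not a sublist of `t`. -/
def search : ℕ → List ℕ → List ℕ → List ℕ → List ℕ → Bool
  | 0, _, _, _, _ => true
  | n + 1, i, a, b, t =>
    b.isSublist t &&
      ((match b, t with
        | x :: b', y :: t' => x == y && search n i a b' t'
        | _, _ => false) ||
      (match i with
        | x :: i' => search n i' (x :: a) b t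
        | [] => false) ||
      (match a with
        | x :: a' => search n i a' (x :: b) t
        | [] => false))

theorem search_of_run_eq_some (w : List Mv) (i a b o t : List ℕ)
    (h : run w ⟨i, a, b, o⟩ = some ⟨[], [], [], o ++ t⟩) :
    search w.length i a b t = true := by
  induction w generalizing i a b o t with
  | nil => rfl
  | cons m w ih =>
    have hb : b.isSublist t = true := by
      obtain ⟨t', ht, hs⟩ := exists_output_of_run_eq_some _ _ _ _ _ _ h
      rw [List.append_cancel_left ht]
      exact List.isSublist_iff_sublist.2 hs
    simp only [List.length_cons, search, hb, Bool.true_and, Bool.or_eq_true]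
    cases m
    · cases i with
      | nil => simp [run, step] at h
      | cons x i => exact .inl (.inr (ih i (x :: a) b o t (by simpa [run, step] using h)))
    · cases a with
      | nil => simp [run, step] at h
      | cons x a => exact .inr (ih i a (x :: b) o t (by simpa [run, step] using h))
    · cases b with
      | nil => simp [run, step] at h
      | cons x b =>
        have h' : run w ⟨i, a, b, o ++ [x]⟩ = some ⟨[], [], [], o ++ t⟩ := by
          simpa [run, step] using h
        obtain ⟨t', ht, -⟩ := exists_output_of_run_eq_some _ _ _ _ _ _ h'
        obtain rfl : t = x :: t' := by simpa using ht
        exact .inl (.inl (by simpa using ih i a b (o ++ [x]) t' (by simpa using h')))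

/-- The permutation 3254761. -/
def unsortablePerm : Equiv.Perm (Fin 7) where
  toFun := ![2, 1, 4, 3, 6, 5, 0]
  invFun := ![6, 1, 0, 3, 2, 5, 4]
  left_inv := by decide
  right_inv := by decide

theorem not_sortable_unsortablePerm : ¬ Sortable unsortablePerm := by
  rintro ⟨w, hw⟩
  have hl : w.length = 21 := by
    simpa [permList] using length_of_run_eq_some w _ _ _ _ _ hw
  have hs := search_of_run_eq_some w _ _ _ [] (idSeq 7) hw
  rw [hl, show permList unsortablePerm = [3, 2, 5, 4, 7, 6, 1] by decide,
    show idSeq 7 = [1, 2, 3, 4, 5, 6, 7] by decide] at hs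
  revert hs
  decide +kernel

theorem exists_unsortable_perm_of_length_seven :
    (∃ p : Equiv.Perm (Fin 7), ¬ Sortable p) ∧
    Nat.card {p : Equiv.Perm (Fin 7) // Sortable p} < Nat.factorial 7 := by
  classical
  refine ⟨⟨unsortablePerm, not_sortable_unsortablePerm⟩, ?_⟩
  rw [Nat.card_eq_fintype_card]
  simpa [Fintype.card_perm] using Fintype.card_subtype_lt not_sortable_unsortablePerm

end TwoStacks
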